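/- Fix an integer k ≥ 2 and x⁰ ∈ [0,1)^d, and set xⁿ := {kⁿ x⁰} (coordinatewise fractional part); for l ∈ ℕ let T_l : [0,1)^d → [0,1)^d be the map T_l(x) = {l·x}. Let q be a minimal idempotent ultrafilter on ℕ₀, let p ∈ βℕ₀ + q, and let S ⊆ [0,1)^d be a semialgebraic set such that xⁿ ∈ S for p-almost all n. Then the set {l ∈ ℕ : T_l(xⁿ) ∈ S for q-almost all n} is IP*₊. -/

import Mathlib

/-- The basic semialgebraic set determined by equations `F` and strict inequalities `G`. -/
def basicSemialg {ι : Type} (F G : Finset (MvPolynomial ι ℝ)) : Set (ι → ℝ) :=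
  {x | (∀ f ∈ F, MvPolynomial.eval x f = 0) ∧ (∀ g ∈ G, 0 < MvPolynomial.eval x g)}

/-- A semialgebraic set: a finite union of basic semialgebraic sets. -/
def IsSemialgebraic {ι : Type} (S : Set (ι → ℝ)) : Prop :=
  ∃ (r : ℕ) (F G : Fin r → Finset (MvPolynomial ι ℝ)),
    S = ⋃ i, basicSemialg (F i) (G i)
/-- Finite sums of a sequence over nonempty finite index sets. -/
def FS (a : ℕ → ℕ) : Set ℕ :=
  {m : ℕ | ∃ I : Finset ℕ, I.Nonempty ∧ m = ∑ i ∈ I, a i}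

/-- A set is IP if it contains the finite sums of a sequence of positive integers. -/
def IsIP (A : Set ℕ) : Prop :=
  ∃ a : ℕ → ℕ, (∀ i, 0 < a i) ∧ FS a ⊆ A

/-- A set is IP* if it meets every IP set. -/
def IsIPStar (E : Set ℕ) : Prop :=
  ∀ A : Set ℕ, IsIP A → (E ∩ A).Nonempty

/-- A set is IP*₊ if some (integer) translate of it is an IP* set. -/
def IsIPStarPlus (E : Set ℕ) : Prop :=
  ∃ t : ℤ, IsIPStar {n : ℕ | ∃ m ∈ E, (m : ℤ) = (n : ℤ) + t}

/-- The sum of two ultrafilters on `ℕ`: `E ∈ usum p q ↔ {n | {m | n + m ∈ E} ∈ q} ∈ p`. -/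
def usum (p q : Ultrafilter ℕ) : Ultrafilter ℕ :=
  p.bind fun n => q.map fun m => n + m

open Filter Topology

lemma eventually_usum {p q : Ultrafilter ℕ} {P : ℕ → Prop} :
    (∀ᶠ n in (usum p q : Filter ℕ), P n) ↔ ∀ᶠ n in (p : Filter ℕ), ∀ᶠ m in (q : Filter ℕ), P (n + m) :=
  Iff.rfl

lemma Filter.Eventually.usum_self {q : Ultrafilter ℕ} (hq : usum q q = q) {P : ℕ → Prop}
    (h : ∀ᶠ n in (q : Filter ℕ), P n) :
    ∀ᶠ n in (q : Filter ℕ), ∀ᶠ m in (q : Filter ℕ), P (n + m) := by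
  rw [← hq] at h
  exact eventually_usum.1 h

/-- A minimal idempotent ultrafilter is not principal. -/
lemma le_atTop_of_minimal {q : Ultrafilter ℕ} (hq : usum q q = q)
    (hmin : ∀ r : Ultrafilter ℕ, ∃ s : Ultrafilter ℕ, usum s (usum r q) = q) :
    (q : Filter ℕ) ≤ atTop := by
  rw [← Nat.cofinite_eq_atTop]
  rcases q.le_cofinite_or_eq_pure with h | ⟨n, hn⟩
  · exact h
  · exfalso
    have h0 : ∀ᶠ i in (q : Filter ℕ), i = n := by rw [hn]; exact rfl
    have h1 := h0.usum_self hq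
    obtain ⟨s, hs⟩ := hmin (pure 1)
    rw [← hs] at h0
    have h2 := eventually_usum.1 h0
    rw [hn] at h1
    have h3 : n + n = n := h1
    obtain ⟨i, hi⟩ := h2.exists
    have h4 := eventually_usum.1 hi
    rw [hn] at h4
    have h5 : i + (1 + n) = n := h4
    omega

lemma Filter.Tendsto.usum_self {X : Type*} [TopologicalSpace X] [RegularSpace X]
    {q : Ultrafilter ℕ} (hq : usum q q = q)
    {h ρ : ℕ → X} {a : X} (ha : Tendsto h q (𝓝 a))
    (hρ : ∀ᶠ m in (q : Filter ℕ), Tendsto (fun m' => h (m + m')) q (𝓝 (ρ m))) :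
    Tendsto ρ q (𝓝 a) := by
  refine (closed_nhds_basis a).tendsto_right_iff.2 ?_
  rintro K ⟨hK, hKc⟩
  filter_upwards [(ha.eventually hK).usum_self hq, hρ] with m hm hm'
  exact hKc.mem_of_tendsto hm' hm

lemma Ultrafilter.exists_tendsto_of_eventually_abs_le {α : Type*} (q : Ultrafilter α) {h : α → ℝ}
    {B : ℝ} (hB : ∀ᶠ m in (q : Filter α), |h m| ≤ B) : ∃ a, Tendsto h q (𝓝 a) := by
  obtain ⟨a, -, ha⟩ := (isCompact_Icc (a := -B) (b := B)).ultrafilter_le_nhds (q.map h)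
    (by
      rw [le_principal_iff]
      exact hB.mono fun m hm => abs_le.1 hm)
  exact ⟨a, ha⟩

/-- If the vectors `c m` transform by matrices asymptotic to diagonal ones with entries
`κ m ^ j σ`, then one coordinate dominates and all coordinates comparable to it
have the same weight. -/
lemma exists_dominant_coordinate {q : Ultrafilter ℕ} (hq : usum q q = q) {τ : Type*}
    [DecidableEq τ]
    (T : Finset τ) (j : τ → ℕ) (c : ℕ → τ → ℝ) (b : ℕ → τ → τ → ℝ) (κ : ℕ → ℝ)
    (hκ : Tendsto κ q atTop)
    (hb : ∀ σ σ', Tendsto (fun m => b m σ σ') q (𝓝 (if σ = σ' then 1 else 0)))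
    (hc : ∀ᶠ m in (q : Filter ℕ), ∀ᶠ m' in (q : Filter ℕ), ∀ σ ∈ T,
      c (m + m') σ = ∑ σ' ∈ T, b m σ σ' * κ m ^ j σ' * c m' σ')
    (hne : ∀ᶠ m in (q : Filter ℕ), ∃ σ ∈ T, c m σ ≠ 0) :
    ∃ s ∈ T, ∃ F : τ → ℝ, F s = 1 ∧ (∀ σ ∈ T, F σ ≠ 0 → j σ = j s) ∧
      (∀ᶠ m in (q : Filter ℕ), c m s ≠ 0) ∧
      ∀ σ ∈ T, Tendsto (fun m => c m σ / c m s) q (𝓝 (F σ)) := by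
  have h1 : ∃ s ∈ T, ∀ᶠ m in (q : Filter ℕ), c m s ≠ 0 ∧ ∀ σ ∈ T, |c m σ| ≤ |c m s| := by
    have : ∀ᶠ m in (q : Filter ℕ), ∃ s ∈ T, c m s ≠ 0 ∧ ∀ σ ∈ T, |c m σ| ≤ |c m s| := by
      filter_upwards [hne] with m hm
      obtain ⟨σ, hσ, hσ0⟩ := hm
      obtain ⟨s, hs, hmax⟩ := T.exists_max_image (fun σ => |c m σ|) ⟨σ, hσ⟩
      refine ⟨s, hs, ?_, hmax⟩
      have := hmax σ hσ
      have h0 := abs_pos.2 hσ0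
      exact abs_pos.1 (h0.trans_le this)
    simpa using (Ultrafilter.eventually_exists_mem_iff (f := q) T.finite_toSet).1 this
  obtain ⟨s, hs, hsm⟩ := h1
  have h2 : ∀ σ, ∃ a, σ ∈ T → Tendsto (fun m => c m σ / c m s) q (𝓝 a) := by
    intro σ
    by_cases hσ : σ ∈ T
    · obtain ⟨a, ha⟩ := q.exists_tendsto_of_eventually_abs_le (B := 1)
        (h := fun m => c m σ / c m s) (by
          filter_upwards [hsm] with m hm
          rw [abs_div]
          exact div_le_one_of_le₀ (hm.2 σ hσ) (abs_nonneg _))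
      exact ⟨a, fun _ => ha⟩
    · exact ⟨0, fun h => absurd h hσ⟩
  choose F hF using h2
  have hFs : F s = 1 := by
    refine tendsto_nhds_unique (hF s hs) (tendsto_const_nhds.congr' ?_)
    filter_upwards [hsm] with m hm
    rw [div_self hm.1]
  obtain ⟨s₁, hs₁, hmax⟩ := (T.filter fun σ => F σ ≠ 0).exists_max_image j
    ⟨s, by simp [hs, hFs]⟩
  rw [Finset.mem_filter] at hs₁
  set J := j s₁
  have hlim : ∀ σ ∈ T, Tendsto (fun m => ∑ σ' ∈ T, b m σ σ' * (κ m ^ j σ' / κ m ^ J) * F σ') q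
      (𝓝 (if j σ = J then F σ else 0)) := by
    intro σ hσ
    have : (if j σ = J then F σ else 0) =
        ∑ σ' ∈ T, (if σ = σ' then 1 else 0) * (if j σ' = J then 1 else 0) * F σ' := by
      rw [Finset.sum_eq_single σ (fun σ' _ h => by simp [h.symm]) (fun h => absurd hσ h)]
      simp
    rw [this]
    refine tendsto_finsetSum _ fun σ' hσ' => ?_
    by_cases h0 : F σ' = 0
    · simp [h0]
    refine ((hb σ σ').mul ?_).mul_const _
    have hle : j σ' ≤ J := hmax σ' (by simp [hσ', h0])
    have hpos : ∀ᶠ m in (q : Filter ℕ), 0 < κ m := hκ.eventually_gt_atTop 0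
    rcases hle.eq_or_lt with he | hlt
    · simp only [he, if_true]
      refine tendsto_const_nhds.congr' ?_
      filter_upwards [hpos] with m hm
      rw [div_self (pow_pos hm _).ne']
    · rw [if_neg hlt.ne]
      have : Tendsto (fun m => (κ m ^ (J - j σ'))⁻¹) q (𝓝 0) :=
        ((tendsto_pow_atTop (by omega)).comp hκ).inv_tendsto_atTop
      refine this.congr' ?_
      filter_upwards [hpos] with m hm
      have : J = (J - j σ') + j σ' := by omega
      rw [this, pow_add]
      have := pow_pos hm (j σ')
      have := pow_pos hm (J - j σ')
      field_simp
      simp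
  have hrel : ∀ σ ∈ T, (if j σ = J then F σ else 0) = F σ * (if j s = J then F s else 0) := by
    intro σ hσ
    obtain ⟨ρ, hρ⟩ : ∃ ρ : ℕ → ℝ, ∀ᶠ m in (q : Filter ℕ),
        Tendsto (fun m' => c (m + m') σ / c (m + m') s) q (𝓝 (ρ m)) := by
      have : ∀ m, ∃ a, (∀ᶠ m' in (q : Filter ℕ), |c (m + m') σ / c (m + m') s| ≤ 1) →
          Tendsto (fun m' => c (m + m') σ / c (m + m') s) q (𝓝 a) := by
        intro m
        by_cases hm : ∀ᶠ m' in (q : Filter ℕ), |c (m + m') σ / c (m + m') s| ≤ 1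
        · obtain ⟨a, ha⟩ := q.exists_tendsto_of_eventually_abs_le hm
          exact ⟨a, fun _ => ha⟩
        · exact ⟨0, fun h => absurd h hm⟩
      choose ρ hρ using this
      refine ⟨ρ, ?_⟩
      filter_upwards [hsm.usum_self hq] with m hm
      refine hρ m (hm.mono fun m' hm' => ?_)
      rw [abs_div]
      exact div_le_one_of_le₀ (hm'.2 σ hσ) (abs_nonneg _)
    have hρF : Tendsto ρ q (𝓝 (F σ)) := (hF σ hσ).usum_self hq hρ
    refine tendsto_nhds_unique (hlim σ hσ) ((hρF.mul (hlim s hs)).congr' ?_)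
    filter_upwards [hρ, hc, hsm.usum_self hq, hκ.eventually_gt_atTop 0] with m h1 h2 h3 h4
    have key : ∀ σ ∈ T, Tendsto (fun m' => c (m + m') σ / c m' s) q
        (𝓝 (∑ σ' ∈ T, b m σ σ' * κ m ^ j σ' * F σ')) := by
      intro σ hσ
      have : Tendsto (fun m' => ∑ σ' ∈ T, b m σ σ' * κ m ^ j σ' * (c m' σ' / c m' s)) q
          (𝓝 (∑ σ' ∈ T, b m σ σ' * κ m ^ j σ' * F σ')) :=
        tendsto_finsetSum _ fun σ' hσ' => (hF σ' hσ').const_mul _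
      refine this.congr' ?_
      filter_upwards [h2] with m' hm'
      rw [hm' σ hσ, Finset.sum_div]
      exact Finset.sum_congr rfl fun _ _ => by ring
    have hmul : ρ m * ∑ σ' ∈ T, b m s σ' * κ m ^ j σ' * F σ' =
        ∑ σ' ∈ T, b m σ σ' * κ m ^ j σ' * F σ' := by
      refine tendsto_nhds_unique (h1.mul (key s hs)) ((key σ hσ).congr' ?_)
      filter_upwards [h3, hsm] with m' hm' hm''
      have := hm'.1
      field_simp
    have hdiv : ∀ σ, ∑ σ' ∈ T, b m σ σ' * (κ m ^ j σ' / κ m ^ J) * F σ' =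
        (∑ σ' ∈ T, b m σ σ' * κ m ^ j σ' * F σ') / κ m ^ J := by
      intro σ
      rw [Finset.sum_div]
      exact Finset.sum_congr rfl fun _ _ => by ring
    rw [hdiv, hdiv, ← hmul]
    ring
  have hjs : j s = J := by
    by_contra hne
    have := hrel s₁ hs₁.1
    rw [if_pos rfl, if_neg hne, mul_zero] at this
    exact hs₁.2 this
  refine ⟨s, hs, F, hFs, fun σ hσ h0 => ?_, hsm.mono fun m hm => hm.1, hF⟩
  have := hrel σ hσ
  rw [if_pos hjs, hFs, mul_one] at this
  by_contra hne
  rw [if_neg (by rwa [← hjs])] at this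
  exact h0 this.symm

namespace MvPolynomial

variable {ι : Type*}

/-- All monomials of `p` have total degree less than `N`. -/
def DegreeLT (N : ℕ) (p : MvPolynomial ι ℝ) : Prop :=
  ∀ s : ι →₀ ℕ, N ≤ s.degree → coeff s p = 0

namespace DegreeLT

lemma add {N : ℕ} {p p' : MvPolynomial ι ℝ} (h : DegreeLT N p) (h' : DegreeLT N p') :
    DegreeLT N (p + p') := fun s hs => by rw [coeff_add, h s hs, h' s hs, add_zero]

lemma smul {N : ℕ} {p : MvPolynomial ι ℝ} (h : DegreeLT N p) (c : ℝ) :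
    DegreeLT N (c • p) := fun s hs => by rw [coeff_smul, h s hs, smul_zero]

lemma sub {N : ℕ} {p p' : MvPolynomial ι ℝ} (h : DegreeLT N p) (h' : DegreeLT N p') :
    DegreeLT N (p - p') := fun s hs => by rw [coeff_sub, h s hs, h' s hs, sub_zero]

lemma mono {N M : ℕ} (hNM : N ≤ M) {p : MvPolynomial ι ℝ} (h : DegreeLT N p) :
    DegreeLT M p := fun s hs => h s (hNM.trans hs)

lemma mul {N M : ℕ} {p p' : MvPolynomial ι ℝ} (h : DegreeLT N p) (h' : DegreeLT (M + 1) p') :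
    DegreeLT (N + M) (p * p') := by
  classical
  intro s hs
  rw [coeff_mul]
  refine Finset.sum_eq_zero fun x hx => ?_
  rw [Finset.HasAntidiagonal.mem_antidiagonal] at hx
  rw [← hx, map_add] at hs
  by_cases h1 : N ≤ x.1.degree
  · rw [h _ h1, zero_mul]
  · rw [h' x.2 (by omega), mul_zero]

lemma mul_sub_mul {N M : ℕ} {p p' r r' : MvPolynomial ι ℝ} (h : DegreeLT N (p - p'))
    (h' : DegreeLT M (r - r')) (hp : DegreeLT (N + 1) p') (hr : DegreeLT (M + 1) r) :
    DegreeLT (N + M) (p * r - p' * r') := by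
  have : p * r - p' * r' = (p - p') * r + (r - r') * p' := by ring
  rw [this]
  exact (h.mul hr).add ((h'.mul hp).mono (by omega))

lemma monomial (s : ι →₀ ℕ) (r : ℝ) : DegreeLT (s.degree + 1) (monomial s r) := by
  classical
  intro s' hs'
  rw [coeff_monomial, if_neg]
  rintro rfl
  omega

end DegreeLT

/-- The substitution `u ↦ a + c u`. -/
noncomputable def homothety (a : ι → ℝ) (c : ℝ) : MvPolynomial ι ℝ →ₐ[ℝ] MvPolynomial ι ℝ :=
  aeval fun i => C (a i) + C c * X i

lemma eval_homothety (a : ι → ℝ) (c : ℝ) (p : MvPolynomial ι ℝ) (u : ι → ℝ) :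
    eval u (homothety a c p) = eval (fun i => a i + c * u i) p := by
  induction p using MvPolynomial.induction_on with
  | C r => simp [homothety]
  | add p p' h h' => simp [h, h']
  | mul_X p i h => rw [map_mul, map_mul, h]; simp [homothety]

lemma degreeLT_homothety_monomial (a : ι → ℝ) (c : ℝ) (s : ι →₀ ℕ) :
    DegreeLT s.degree (homothety a c (monomial s 1) - c ^ s.degree • monomial s 1) := by
  have hupper : ∀ s : ι →₀ ℕ,
      DegreeLT s.degree (homothety a c (monomial s 1) - c ^ s.degree • monomial s 1) →
      DegreeLT (s.degree + 1) (homothety a c (monomial s 1)) := fun s hs => by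
    have := (hs.mono (Nat.le_succ _)).add ((DegreeLT.monomial s 1).smul (c ^ s.degree))
    rwa [sub_add_cancel] at this
  have hadd : ∀ s s' : ι →₀ ℕ,
      DegreeLT s.degree (homothety a c (monomial s 1) - c ^ s.degree • monomial s 1) →
      DegreeLT s'.degree (homothety a c (monomial s' 1) - c ^ s'.degree • monomial s' 1) →
      DegreeLT (s + s').degree
        (homothety a c (monomial (s + s') 1) - c ^ (s + s').degree • monomial (s + s') 1) := by
    intro s s' h h'
    have := h.mul_sub_mul h' ((DegreeLT.monomial s 1).smul (c ^ s.degree)) (hupper s' h')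
    rw [smul_mul_smul_comm, ← pow_add, ← map_mul, monomial_mul, mul_one] at this
    rwa [map_add]
  have hzero : DegreeLT (0 : ι →₀ ℕ).degree
      (homothety a c (monomial (0 : ι →₀ ℕ) 1) -
        c ^ (0 : ι →₀ ℕ).degree • monomial (0 : ι →₀ ℕ) 1) := by
    intro s _
    simp
  induction s using Finsupp.induction_linear with
  | zero => exact hzero
  | add s s' h h' => exact hadd s s' h h'
  | single i n =>
    induction n with
    | zero => rw [Finsupp.single_zero]; exact hzero
    | succ n ih =>
      rw [Finsupp.single_add]
      refine hadd _ _ ih ?_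
      have : homothety a c (monomial (Finsupp.single i 1) 1) -
          c ^ (Finsupp.single i 1).degree • monomial (Finsupp.single i 1) 1 = C (a i) := by
        have : monomial (Finsupp.single i 1) (1 : ℝ) = X i := rfl
        rw [this, Finsupp.degree_single, pow_one, smul_eq_C_mul, homothety, aeval_X]
        ring
      rw [this]
      refine DegreeLT.mono ?_ (DegreeLT.monomial 0 (a i))
      simp

lemma degreeLT_homothety_sub (a : ι → ℝ) (c : ℝ) {N : ℕ} {p : MvPolynomial ι ℝ}
    (hp : DegreeLT (N + 1) p) : DegreeLT N (homothety a c p - c ^ N • p) := by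
  have hmon : ∀ s ∈ p.support, DegreeLT N
      (homothety a c (monomial s (coeff s p)) - c ^ N • monomial s (coeff s p)) := by
    intro s hs
    have hle : s.degree ≤ N := by
      by_contra hlt
      exact (mem_support_iff.1 hs) (hp s (by omega))
    have hr : monomial s (coeff s p) = coeff s p • monomial s (1 : ℝ) := by
      rw [smul_monomial, smul_eq_mul, mul_one]
    have h1 := degreeLT_homothety_monomial a c s
    rw [hr, map_smul, smul_comm, ← smul_sub]
    refine DegreeLT.smul ?_ _
    rcases hle.eq_or_lt with he | hlt
    · rwa [he] at h1
    · have h2 := ((h1.mono (Nat.le_succ _)).add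
        ((DegreeLT.monomial s 1).smul (c ^ s.degree))).mono (Nat.succ_le_of_lt hlt)
      rw [sub_add_cancel] at h2
      exact h2.sub (((DegreeLT.monomial s 1).mono (Nat.succ_le_of_lt hlt)).smul _)
  have hsum : homothety a c p - c ^ N • p =
      ∑ s ∈ p.support, (homothety a c (monomial s (coeff s p)) -
        c ^ N • monomial s (coeff s p)) := by
    rw [Finset.sum_sub_distrib, ← map_sum, ← Finset.smul_sum, support_sum_monomial_coeff]
  rw [hsum]
  intro s hs
  rw [coeff_sum]
  exact Finset.sum_eq_zero fun s' hs' => hmon s' hs' s hs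

/-- The restriction of a polynomial to the line `w + s v`. -/
noncomputable def restrictLine (w v : ι → ℝ) : MvPolynomial ι ℝ →ₐ[ℝ] Polynomial ℝ :=
  aeval fun i => Polynomial.C (w i) + Polynomial.X * Polynomial.C (v i)

lemma eval_restrictLine (w v : ι → ℝ) (p : MvPolynomial ι ℝ) (s : ℝ) :
    (restrictLine w v p).eval s = eval (fun i => w i + s * v i) p := by
  induction p using MvPolynomial.induction_on with
  | C r => simp [restrictLine]
  | add p p' h h' => simp [h, h']
  | mul_X p i h => rw [map_mul, map_mul, Polynomial.eval_mul, h]; simp [restrictLine, mul_comm s]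

/-- A polynomial that is homogeneous about `w` for one ratio `K > 1` is homogeneous about `w`. -/
lemma eval_homogeneous_about {p : MvPolynomial ι ℝ} {w : ι → ℝ} {K : ℝ} (hK : 1 < K) {N : ℕ}
    (h : ∀ v : ι → ℝ, eval (fun i => w i + K * v i) p = K ^ N * eval (fun i => w i + v i) p)
    (s : ℝ) (v : ι → ℝ) :
    eval (fun i => w i + s * v i) p = s ^ N * eval (fun i => w i + v i) p := by
  have hpow : ∀ n : ℕ, eval (fun i => w i + K ^ n * v i) p =
      (K ^ n) ^ N * eval (fun i => w i + v i) p := by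
    intro n
    induction n with
    | zero => simp
    | succ n ih =>
      have := h fun i => K ^ n * v i
      rw [ih] at this
      have e : (fun i => w i + K ^ (n + 1) * v i) = fun i => w i + K * (K ^ n * v i) := by
        funext i; ring
      rw [e, this]
      ring
  have hpoly : restrictLine w v p =
      Polynomial.X ^ N * Polynomial.C (eval (fun i => w i + v i) p) := by
    refine Polynomial.eq_of_infinite_eval_eq _ _ (Set.Infinite.mono ?_
      (Set.infinite_range_of_injective (pow_right_injective₀ (by linarith) hK.ne')))
    rintro _ ⟨n, rfl⟩
    simp only [Set.mem_ofPred_eq, eval_restrictLine, Polynomial.eval_mul, Polynomial.eval_pow,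
      Polynomial.eval_X, Polynomial.eval_C]
    exact hpow n
  have := congrArg (Polynomial.eval s) hpoly
  simpa [eval_restrictLine, mul_comm (s ^ N)] using this

end MvPolynomial

open MvPolynomial in
/-- If `η` satisfies the cocycle identity along an idempotent ultrafilter `q`, and its values
span on every member of `q`, then its values are Zariski dense on every member of `q`. -/
lemma MvPolynomial.eq_zero_of_eventually_eval_eq_zero {q : Ultrafilter ℕ} (hq : usum q q = q)
    {ι : Type*} [Finite ι] {κ : ℕ → ℝ} (hκ : Tendsto κ q atTop) {η : ℕ → ι → ℝ}
    (hη : Tendsto η q (𝓝 0))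
    (hcocycle : ∀ᶠ m in (q : Filter ℕ), ∀ᶠ m' in (q : Filter ℕ), η (m + m') = η m + κ m • η m')
    (hspan : ∀ M : Set ℕ, (∀ᶠ m in (q : Filter ℕ), m ∈ M) → Submodule.span ℝ (η '' M) = ⊤)
    (g : MvPolynomial ι ℝ) (hg : ∀ᶠ m in (q : Filter ℕ), eval (η m) g = 0) : g = 0 := by
  suffices H : ∀ N : ℕ, ∀ g : MvPolynomial ι ℝ, DegreeLT N g →
      (∀ᶠ m in (q : Filter ℕ), eval (η m) g = 0) → g = 0 by
    refine H (g.totalDegree + 1) g (fun s hs => ?_) hg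
    by_contra hne
    have := le_totalDegree (mem_support_iff.2 hne)
    rw [Finsupp.degree_apply] at hs
    rw [Finsupp.sum] at this
    omega
  intro N
  induction N with
  | zero =>
    intro g hg _
    ext s
    rw [hg s (Nat.zero_le _), coeff_zero]
  | succ N ih =>
    intro g hdeg hg
    set w : ℕ → ι → ℝ := fun m => -((κ m - 1)⁻¹ • η m) with hw
    have hhom : ∀ᶠ m in (q : Filter ℕ), ∀ (s : ℝ) (v : ι → ℝ),
        eval (fun i => w m i + s * v i) g = s ^ N * eval (fun i => w m i + v i) g := by
      filter_upwards [hg.usum_self hq, hcocycle, hκ.eventually_gt_atTop 1] with m h1 h2 h3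
      have hz : homothety (η m) (κ m) g - κ m ^ N • g = 0 := by
        refine ih _ (degreeLT_homothety_sub _ _ hdeg) ?_
        filter_upwards [h1, h2, hg] with m' h1' h2' h3'
        rw [map_sub, smul_eval, eval_homothety, h3', mul_zero, sub_zero]
        rw [h2'] at h1'
        exact h1'
      refine eval_homogeneous_about h3 fun v => ?_
      have := congrArg (eval fun i => w m i + v i) hz
      rw [map_sub, smul_eval, eval_homothety, map_zero, sub_eq_zero] at this
      rw [← this]
      congr 2
      funext i
      have : κ m - 1 ≠ 0 := by linarith
      simp only [hw, Pi.neg_apply, Pi.smul_apply, smul_eq_mul]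
      field_simp
      ring
    have hw0 : Tendsto w q (𝓝 0) := by
      have h1 : Tendsto (fun m => (κ m - 1)⁻¹) q (𝓝 0) :=
        (tendsto_atTop_add_const_right (q : Filter ℕ) (-1 : ℝ) hκ).inv_tendsto_atTop
      have := (h1.smul hη).neg
      simpa using this
    have hcont : ∀ v : ι → ℝ, Tendsto (fun m => eval (fun i => w m i + v i) g) q
        (𝓝 (eval v g)) := by
      intro v
      have h1 : Tendsto (fun m => (fun i => w m i + v i)) q (𝓝 v) := by
        have := hw0.add_const v
        rwa [zero_add] at this
      exact ((continuous_eval g).tendsto v).comp h1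
    have hhom0 : ∀ (s : ℝ) (v : ι → ℝ),
        eval (fun i => s * v i) g = s ^ N * eval v g := by
      intro s v
      refine tendsto_nhds_unique (hcont fun i => s * v i) (((hcont v).const_mul _).congr' ?_)
      filter_upwards [hhom] with m hm
      rw [hm]
    have htrans : ∀ᶠ m in (q : Filter ℕ), ∀ (r : ℝ) (u : ι → ℝ),
        eval (u + r • w m) g = eval u g := by
      filter_upwards [hhom] with m hm
      have h1 : ∀ (r : ℝ), r ≠ -1 → ∀ (u : ι → ℝ), eval (u + r • w m) g = eval u g := by
        intro r hr u
        have hr' : r + 1 ≠ 0 := fun h => hr (by linarith)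
        have h2 := hm (r + 1)⁻¹ (u - w m)
        have h3 := hhom0 (r + 1)⁻¹ (u + r • w m)
        have e1 : (fun i => w m i + (r + 1)⁻¹ * (u - w m) i) =
            fun i => (r + 1)⁻¹ * (u + r • w m) i := by
          funext i
          simp only [Pi.sub_apply, Pi.add_apply, Pi.smul_apply, smul_eq_mul]
          field_simp
          ring
        have e2 : (fun i => w m i + (u - w m) i) = u := by
          funext i
          simp
        rw [e1, h3, e2] at h2
        exact mul_left_cancel₀ (pow_ne_zero _ (inv_ne_zero hr')) h2
      intro r u
      by_cases hr : r = -1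
      · have e : u + r • w m = (u + (r / 2) • w m) + (r / 2) • w m := by
          rw [add_assoc, ← add_smul, add_halves]
        rw [e, h1 _ (by rw [hr]; norm_num), h1 _ (by rw [hr]; norm_num)]
      · exact h1 r hr u
    let H : Submodule ℝ (ι → ℝ) :=
      { carrier := {v | ∀ (r : ℝ) (u : ι → ℝ), eval (u + r • v) g = eval u g}
        zero_mem' := by intro r u; simp
        add_mem' := by
          intro v v' hv hv' r u
          rw [smul_add, ← add_assoc, hv', hv]
        smul_mem' := by
          intro a v hv r u
          rw [smul_smul, hv] }
    have hH : H = ⊤ := by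
      rw [eq_top_iff, ← hspan {m | η m ∈ H} ?_, Submodule.span_le]
      · rintro _ ⟨m, hm, rfl⟩
        exact hm
      · filter_upwards [htrans, hκ.eventually_gt_atTop 1] with m hm hm'
        have hwm : w m ∈ H := hm
        have : η m = -(κ m - 1) • w m := by
          have : κ m - 1 ≠ 0 := by linarith
          rw [hw]
          simp only [smul_neg, neg_smul, neg_neg]
          rw [smul_smul, mul_inv_cancel₀ this, one_smul]
        change η m ∈ H
        rw [this]
        exact H.smul_mem _ hwm
    have hconst : ∀ u v : ι → ℝ, eval (u + v) g = eval u g := by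
      intro u v
      have hv : v ∈ H := hH ▸ Submodule.mem_top
      simpa using hv 1 u
    refine MvPolynomial.funext fun u => ?_
    obtain ⟨m, hm⟩ := hg.exists
    have := hconst (η m) (u - η m)
    rw [hm] at this
    rw [map_zero, ← this]
    congr 2
    abel

namespace MvPolynomial

variable {ι τ : Type*}

/-- The substitution `(u, t) ↦ (u + t η, c t)`, where `t` is the variable `none`. -/
noncomputable def shear (η : ι → ℝ) (c : ℝ) :
    MvPolynomial (Option ι) ℝ →ₐ[ℝ] MvPolynomial (Option ι) ℝ :=
  aeval fun o => o.elim (C c * X none) fun i => X (some i) + C (η i) * X none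

lemma eval_shear (η : ι → ℝ) (c : ℝ) (p : MvPolynomial (Option ι) ℝ) (y : Option ι → ℝ) :
    eval y (shear η c p) =
      eval (fun o => o.elim (c * y none) fun i => y (some i) + η i * y none) p := by
  induction p using MvPolynomial.induction_on with
  | C r => simp [shear]
  | add p p' h h' => simp [h, h']
  | mul_X p o h => rw [map_mul, map_mul, h]; cases o <;> simp [shear]

lemma shear_monomial [Fintype ι] (η : ι → ℝ) (c r : ℝ) (σ : Option ι →₀ ℕ) :
    shear η c (monomial σ r) = (c ^ σ none * r) • shear η 1 (monomial σ 1) := by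
  refine MvPolynomial.funext fun y => ?_
  rw [smul_eval, eval_shear, eval_shear, eval_monomial, eval_monomial,
    Finsupp.prod_fintype _ _ (by simp), Finsupp.prod_fintype _ _ (by simp),
    Fintype.prod_option, Fintype.prod_option]
  simp only [Option.elim]
  ring

lemma continuous_coeff_shear (p : MvPolynomial (Option ι) ℝ) (σ : Option ι →₀ ℕ) :
    Continuous fun η : ι → ℝ => coeff σ (shear η 1 p) := by
  classical
  induction p using MvPolynomial.induction_on generalizing σ with
  | C r => simpa [shear] using continuous_const
  | add p p' h h' =>
    simp only [map_add, coeff_add]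
    exact (h σ).add (h' σ)
  | mul_X p o h =>
    simp only [map_mul, coeff_mul]
    refine continuous_finsetSum _ fun x _ => (h _).mul ?_
    cases o with
    | none => simpa [shear] using continuous_const
    | some i =>
      simp only [shear, aeval_X, Option.elim, coeff_add, coeff_C_mul]
      fun_prop

lemma tendsto_coeff_shear [DecidableEq ι] {q : Filter ℕ} {η : ℕ → ι → ℝ} (hη : Tendsto η q (𝓝 0))
    (σ σ' : Option ι →₀ ℕ) :
    Tendsto (fun m => coeff σ (shear (η m) 1 (monomial σ' 1))) q
      (𝓝 (if σ = σ' then 1 else 0)) := by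
  have h := ((continuous_coeff_shear (monomial σ' 1) σ).tendsto 0).comp hη
  have h0 : shear (0 : ι → ℝ) 1 (monomial σ' 1) = monomial σ' 1 := by
    refine MvPolynomial.funext fun y => ?_
    rw [eval_shear]
    congr 2
    funext o
    cases o <;> simp
  rw [h0, coeff_monomial] at h
  simpa [eq_comm, Function.comp_def] using h

/-- The substitution of `z + ∑ uᵢ bᵢ + t ε` into a polynomial, where `t` is the variable `none`. -/
noncomputable def affineSubst [Fintype ι] (z : τ → ℝ) (b : ι → τ → ℝ) (ε : τ → ℝ) :
    MvPolynomial τ ℝ →ₐ[ℝ] MvPolynomial (Option ι) ℝ :=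
  aeval fun k => C (z k) + ∑ i, C (b i k) * X (some i) + C (ε k) * X none

variable [Fintype ι]

lemma eval_affineSubst (z : τ → ℝ) (b : ι → τ → ℝ) (ε : τ → ℝ) (f : MvPolynomial τ ℝ)
    (y : Option ι → ℝ) :
    eval y (affineSubst z b ε f) = eval (z + ∑ i, y (some i) • b i + y none • ε) f := by
  induction f using MvPolynomial.induction_on with
  | C r => simp [affineSubst]
  | add p p' h h' => simp [h, h']
  | mul_X p k h =>
    rw [map_mul, map_mul, h]
    simp [affineSubst, mul_comm]

lemma affineSubst_shear (z : τ → ℝ) (b : ι → τ → ℝ) (ε : τ → ℝ) (η : ι → ℝ) (c : ℝ)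
    (f : MvPolynomial τ ℝ) :
    affineSubst z b (∑ i, η i • b i + c • ε) f = shear η c (affineSubst z b ε f) := by
  refine MvPolynomial.funext fun y => ?_
  rw [eval_shear, eval_affineSubst, eval_affineSubst]
  congr 2
  simp only [Option.elim, add_smul, Finset.sum_add_distrib, smul_add, Finset.smul_sum, mul_smul]
  have : ∀ i, y none • η i • b i = η i • y none • b i := fun i => smul_comm _ _ _
  simp only [this, smul_comm c (y none) ε]
  abel

lemma exists_support_affineSubst_subset (z : τ → ℝ) (b : ι → τ → ℝ) (f : MvPolynomial τ ℝ) :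
    ∃ T : Finset (Option ι →₀ ℕ), ∀ ε : τ → ℝ, (affineSubst z b ε f).support ⊆ T := by
  classical
  induction f using MvPolynomial.induction_on with
  | C r => exact ⟨(C r).support, fun ε => by simp [affineSubst]⟩
  | add p p' h h' =>
    obtain ⟨T, hT⟩ := h
    obtain ⟨T', hT'⟩ := h'
    refine ⟨T ∪ T', fun ε => ?_⟩
    rw [map_add]
    exact support_add.trans (Finset.union_subset_union (hT ε) (hT' ε))
  | mul_X p k h =>
    obtain ⟨T, hT⟩ := h
    let A : Finset (Option ι →₀ ℕ) :=
      insert 0 (Finset.univ.image fun o => Finsupp.single o 1)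
    have hX : ∀ (r : ℝ) (o : Option ι), (C r * X o : MvPolynomial (Option ι) ℝ).support ⊆ A := by
      intro r o σ hσ
      rw [C_mul_X_eq_monomial] at hσ
      have := support_monomial_subset hσ
      rw [Finset.mem_singleton] at this
      exact Finset.mem_insert_of_mem (Finset.mem_image.2 ⟨o, Finset.mem_univ _, this.symm⟩)
    have hC : ∀ r : ℝ, (C r : MvPolynomial (Option ι) ℝ).support ⊆ A := by
      intro r σ hσ
      have := support_monomial_subset hσ
      rw [Finset.mem_singleton] at this
      exact this ▸ Finset.mem_insert_self _ _
    refine ⟨Finset.image₂ (· + ·) T A, fun ε => ?_⟩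
    rw [map_mul]
    have hA : (affineSubst z b ε (X k)).support ⊆ A := by
      rw [affineSubst, aeval_X]
      refine support_add.trans (Finset.union_subset (support_add.trans
        (Finset.union_subset (hC _) ?_)) (hX _ _))
      exact support_sum.trans (Finset.biUnion_subset.2 fun i _ => hX _ _)
    exact (support_mul _ _).trans (Finset.image₂_subset (hT ε) hA)

lemma eval_eq_sum_of_support_subset {T : Finset (Option ι →₀ ℕ)} {p : MvPolynomial (Option ι) ℝ}
    (hp : p.support ⊆ T) (y : Option ι → ℝ) :
    eval y p = ∑ σ ∈ T, coeff σ p * ∏ o, y o ^ σ o := by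
  rw [eval_eq']
  exact Finset.sum_subset hp fun σ _ hσ => by rw [notMem_support_iff.1 hσ, zero_mul]

lemma coeff_shear_of_support_subset {T : Finset (Option ι →₀ ℕ)} {p : MvPolynomial (Option ι) ℝ}
    (hp : p.support ⊆ T) (η : ι → ℝ) (c : ℝ) (σ : Option ι →₀ ℕ) :
    coeff σ (shear η c p) =
      ∑ σ' ∈ T, coeff σ (shear η 1 (monomial σ' 1)) * c ^ σ' none * coeff σ' p := by
  have h : p = ∑ σ' ∈ T, monomial σ' (coeff σ' p) := by
    conv_lhs => rw [← support_sum_monomial_coeff p]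
    exact Finset.sum_subset hp fun σ _ hσ => by rw [notMem_support_iff.1 hσ, monomial_zero]
  conv_lhs => rw [h]
  rw [map_sum, coeff_sum]
  refine Finset.sum_congr rfl fun σ' _ => ?_
  rw [shear_monomial, coeff_smul, smul_eq_mul]
  ring

end MvPolynomial

lemma Filter.Tendsto.eventually_sign_eq {α : Type*} {q : Filter α} {h : α → ℝ} {a : ℝ}
    (hh : Tendsto h q (𝓝 a)) (ha : a ≠ 0) :
    ∀ᶠ m in q, SignType.sign (h m) = SignType.sign a := by
  have := (continuousAt_sign_of_ne_zero ha).tendsto.comp hh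
  rw [nhds_discrete, tendsto_pure] at this
  exact this

open MvPolynomial in
/-- The sign of a polynomial at the points `z + ε m` is also its sign at nearby points obtained
by perturbing the `η`-part and rescaling the remaining part. -/
lemma eventually_sign_eval_perturbed {q : Ultrafilter ℕ} (hq : usum q q = q)
    {ι τ : Type*} [Fintype ι] {κ : ℕ → ℝ} (hκ : Tendsto κ q atTop)
    (z : τ → ℝ) (b : ι → τ → ℝ) {ε : ℕ → τ → ℝ} {η : ℕ → ι → ℝ} (hη : Tendsto η q (𝓝 0))
    (hcocycle : ∀ᶠ m in (q : Filter ℕ), ∀ᶠ m' in (q : Filter ℕ), η (m + m') = η m + κ m • η m')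
    (hspan : ∀ M : Set ℕ, (∀ᶠ m in (q : Filter ℕ), m ∈ M) → Submodule.span ℝ (η '' M) = ⊤)
    (hε : ∀ᶠ m in (q : Filter ℕ), ∀ᶠ m' in (q : Filter ℕ),
      ε (m + m') = ∑ i, η m i • b i + κ m • ε m')
    (f : MvPolynomial τ ℝ) {s : SignType}
    (hs : ∀ᶠ m in (q : Filter ℕ), SignType.sign (eval (z + ε m) f) = s) :
    ∀ᶠ m in (q : Filter ℕ), ∀ᶠ θ in 𝓝 (0 : ι → ℝ), ∀ t : ℝ, 0 < t → ∀ᶠ m' in (q : Filter ℕ),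
      SignType.sign (eval (z + ∑ i, (η m i + θ i) • b i + t • ε m') f) = s := by
  classical
  obtain ⟨T, hT⟩ := exists_support_affineSubst_subset z b f
  set c : ℕ → (Option ι →₀ ℕ) → ℝ := fun m σ => coeff σ (affineSubst z b (ε m) f) with hc
  have hval : ∀ (m : ℕ) (u : ι → ℝ) (t : ℝ), eval (z + ∑ i, u i • b i + t • ε m) f =
      ∑ σ ∈ T, c m σ * (t ^ σ none * ∏ i, u i ^ σ (some i)) := by
    intro m u t
    have h1 := eval_affineSubst z b (ε m) f (fun o => o.elim t u)
    rw [eval_eq_sum_of_support_subset (hT (ε m))] at h1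
    simp only [Fintype.prod_option, Option.elim] at h1
    exact h1.symm
  by_cases hne : ∀ᶠ m in (q : Filter ℕ), ∃ σ ∈ T, c m σ ≠ 0
  swap
  · rw [← Ultrafilter.eventually_not] at hne
    have hzero : ∀ᶠ m in (q : Filter ℕ), ∀ (u : ι → ℝ) (t : ℝ),
        eval (z + ∑ i, u i • b i + t • ε m) f = 0 := by
      filter_upwards [hne] with m hm u t
      push Not at hm
      rw [hval]
      exact Finset.sum_eq_zero fun σ hσ => by rw [hm σ hσ, zero_mul]
    obtain ⟨m, hm, hm'⟩ := (hs.and hzero).exists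
    have h0 := hm' 0 1
    simp only [Pi.zero_apply, zero_smul, Finset.sum_const_zero, add_zero, one_smul] at h0
    rw [h0, sign_zero] at hm
    refine Eventually.of_forall fun m => Eventually.of_forall fun θ t _ => ?_
    filter_upwards [hzero] with m' hm''
    rw [hm'' (fun i => η m i + θ i), sign_zero, hm]
  obtain ⟨σ₀, hσ₀, F, hF₀, hFJ, hc₀, hF⟩ := exists_dominant_coordinate hq T (fun σ => σ none) c
    (fun m σ σ' => coeff σ (shear (η m) 1 (monomial σ' 1))) κ hκ
    (fun σ σ' => by convert tendsto_coeff_shear hη σ σ') (by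
      filter_upwards [hε] with m hm
      filter_upwards [hm] with m' hm' σ _
      simp only [hc]
      rw [hm', affineSubst_shear, coeff_shear_of_support_subset (hT _)]) hne
  set J := σ₀ none
  set Φ : MvPolynomial (Option ι) ℝ := ∑ σ ∈ T, monomial σ (F σ) with hΦ
  have hΦ_eval : ∀ y : Option ι → ℝ, eval y Φ =
      ∑ σ ∈ T, F σ * (y none ^ σ none * ∏ i, y (some i) ^ σ (some i)) := by
    intro y
    rw [hΦ, map_sum]
    refine Finset.sum_congr rfl fun σ _ => ?_
    rw [eval_monomial, Finsupp.prod_fintype _ _ (by simp), Fintype.prod_option]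
  set G : MvPolynomial ι ℝ := aeval (fun o : Option ι => o.elim 1 X) Φ with hG
  have hGeval : ∀ u : ι → ℝ, eval u G = ∑ σ ∈ T, F σ * ∏ i, u i ^ σ (some i) := by
    intro u
    have h1 : eval u G = eval (fun o : Option ι => o.elim 1 u) Φ := by
      rw [hG]
      generalize Φ = p
      induction p using MvPolynomial.induction_on with
      | C r => simp
      | add p p' h h' => rw [map_add, map_add, map_add, h, h']
      | mul_X p o h => rw [map_mul, map_mul, h]; cases o <;> simp
    rw [h1, hΦ_eval]
    simp
  have hsplit : ∀ (u : ι → ℝ) (t : ℝ),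
      ∑ σ ∈ T, F σ * (t ^ σ none * ∏ i, u i ^ σ (some i)) = t ^ J * eval u G := by
    intro u t
    rw [hGeval, Finset.mul_sum]
    refine Finset.sum_congr rfl fun σ hσ => ?_
    by_cases h0 : F σ = 0
    · simp [h0]
    · have hJ : σ none = J := hFJ σ hσ h0
      rw [hJ]
      ring
  have hG0 : G ≠ 0 := by
    intro h0
    have h1 : Φ = 0 := by
      refine MvPolynomial.funext fun y => ?_
      rw [hΦ_eval, hsplit (fun i => y (some i)) (y none), h0]
      simp
    have h2 : coeff σ₀ Φ = 1 := by
      rw [hΦ, coeff_sum]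
      simp [coeff_monomial, hσ₀, hF₀]
    rw [h1, coeff_zero] at h2
    exact zero_ne_one h2
  have hGη : ∀ᶠ m in (q : Filter ℕ), eval (η m) G ≠ 0 := by
    rw [Ultrafilter.eventually_not]
    exact fun h => hG0 (eq_zero_of_eventually_eval_eq_zero hq hκ hη hcocycle hspan G h)
  obtain ⟨s', hs'⟩ := (Ultrafilter.eventually_exists_iff (f := q)
    (P := fun (s' : SignType) m => SignType.sign (c m σ₀) = s')).1
    (Eventually.of_forall fun m => ⟨_, rfl⟩)
  have hsign : ∀ u : ι → ℝ, eval u G ≠ 0 → ∀ t : ℝ, 0 < t → ∀ᶠ m in (q : Filter ℕ),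
      SignType.sign (eval (z + ∑ i, u i • b i + t • ε m) f) =
        s' * SignType.sign (eval u G) := by
    intro u hu t ht
    have hlim : Tendsto (fun m => ∑ σ ∈ T, c m σ / c m σ₀ *
        (t ^ σ none * ∏ i, u i ^ σ (some i))) q (𝓝 (t ^ J * eval u G)) := by
      rw [← hsplit]
      exact tendsto_finsetSum _ fun σ hσ => (hF σ hσ).mul_const _
    filter_upwards [hlim.eventually_sign_eq (mul_ne_zero (pow_pos ht _).ne' hu), hs', hc₀]
      with m h1 h2 h3
    rw [sign_mul, sign_pos (pow_pos ht _), one_mul] at h1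
    rw [hval, ← h1, ← h2, ← sign_mul, Finset.mul_sum]
    congr 1
    refine Finset.sum_congr rfl fun σ _ => ?_
    field_simp
  filter_upwards [hGη, hε, hs.usum_self hq, hκ.eventually_gt_atTop 0] with m h1 h2 h3 h4
  have hse : s' * SignType.sign (eval (η m) G) = s := by
    obtain ⟨m', h1', h2', h3'⟩ := ((hsign (η m) h1 (κ m) h4).and (h2.and h3)).exists
    rw [← h1', ← h3', h2', add_assoc]
  have hcont : Tendsto (fun θ : ι → ℝ => eval (fun i => η m i + θ i) G) (𝓝 0)
      (𝓝 (eval (η m) G)) := by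
    have h5 : Continuous fun θ : ι → ℝ => eval (fun i => η m i + θ i) G :=
      (continuous_eval G).comp (by fun_prop)
    have := h5.tendsto 0
    simpa using this
  filter_upwards [hcont.eventually_sign_eq h1] with θ hθ t ht
  have hne' : eval (fun i => η m i + θ i) G ≠ 0 := by
    intro h0
    rw [h0, sign_zero] at hθ
    exact h1 (sign_eq_zero_iff.1 hθ.symm)
  rw [← hse, ← hθ]
  exact hsign _ hne' t ht

/-- If `δ m` is congruent to `(κ m - 1) v` modulo the integer lattice and tends to `0`, then
it lives, without degeneracy, in a rational subspace. -/
lemma exists_integer_coordinates (q : Ultrafilter ℕ) {τ : Type} [Finite τ] {κ : ℕ → ℤ}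
    (hκ : Tendsto (fun m => (κ m : ℝ)) q atTop) {δ : ℕ → τ → ℝ} (hδ : Tendsto δ q (𝓝 0))
    (v : τ → ℝ) (hv : ∀ m, ∃ c : τ → ℤ, ∀ i, δ m i = ((κ m : ℝ) - 1) * v i - c i) :
    ∃ (ι : Type) (_ : Fintype ι) (b : ι → τ → ℤ) (P : (τ → ℝ) →ₗ[ℝ] (ι → ℝ)),
      (∀ᶠ m in (q : Filter ℕ), δ m = ∑ i, P (δ m) i • fun k => (b i k : ℝ)) ∧
      ∀ M : Set ℕ, (∀ᶠ m in (q : Filter ℕ), m ∈ M) →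
        Submodule.span ℝ ((fun m => P (δ m)) '' M) = ⊤ := by
  classical
  obtain ⟨M₀, hM₀, hmin⟩ : ∃ M₀ : Set ℕ, (∀ᶠ m in (q : Filter ℕ), m ∈ M₀) ∧
      ∀ M : Set ℕ, (∀ᶠ m in (q : Filter ℕ), m ∈ M) →
        Submodule.span ℝ (δ '' M₀) ≤ Submodule.span ℝ (δ '' M) := by
    obtain ⟨M₀, hM₀, h⟩ := exists_minimalFor_of_wellFoundedLT
      (fun M : Set ℕ => ∀ᶠ m in (q : Filter ℕ), m ∈ M)
      (fun M => Module.finrank ℝ (Submodule.span ℝ (δ '' M)))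
      ⟨Set.univ, Eventually.of_forall fun _ => Set.mem_univ _⟩
    refine ⟨M₀, hM₀, fun M hM => ?_⟩
    have hle : Submodule.span ℝ (δ '' (M₀ ∩ M)) ≤ Submodule.span ℝ (δ '' M₀) :=
      Submodule.span_mono (Set.image_mono Set.inter_subset_left)
    have := h (j := M₀ ∩ M) (hM₀.and hM) (Submodule.finrank_mono hle)
    rw [← Submodule.eq_of_le_of_finrank_le hle this]
    exact Submodule.span_mono (Set.image_mono Set.inter_subset_right)
  set U := Submodule.span ℝ (δ '' M₀) with hU
  let W : Set (τ → ℝ) := {w | w ∈ U ∧ ∃ c : τ → ℤ, w = fun k => (c k : ℝ)}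
  have hWU : Submodule.span ℝ W ≤ U := Submodule.span_le.2 fun w hw => hw.1
  have hδW : ∀ᶠ m in (q : Filter ℕ), δ m ∈ Submodule.span ℝ W := by
    filter_upwards [hM₀] with m hm
    have hlim : Tendsto (fun m' => δ m - (((κ m : ℝ) - 1) * ((κ m' : ℝ) - 1)⁻¹) • δ m') q
        (𝓝 (δ m)) := by
      have h1 : Tendsto (fun m' => ((κ m' : ℝ) - 1)⁻¹) q (𝓝 0) :=
        (tendsto_atTop_add_const_right (q : Filter ℕ) (-1 : ℝ) hκ).inv_tendsto_atTop
      have := ((h1.const_mul ((κ m : ℝ) - 1)).smul hδ).const_sub (δ m)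
      simpa using this
    refine (Submodule.closed_of_finiteDimensional (Submodule.span ℝ W)).mem_of_tendsto hlim ?_
    filter_upwards [hM₀, hκ.eventually_gt_atTop 1] with m' hm' hgt
    have hne : (κ m' : ℝ) - 1 ≠ 0 := by linarith
    have hmem : ((κ m' : ℝ) - 1) • δ m - ((κ m : ℝ) - 1) • δ m' ∈ W := by
      refine ⟨U.sub_mem (U.smul_mem _ (Submodule.subset_span ⟨m, hm, rfl⟩))
        (U.smul_mem _ (Submodule.subset_span ⟨m', hm', rfl⟩)), ?_⟩
      obtain ⟨c, hc⟩ := hv m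
      obtain ⟨c', hc'⟩ := hv m'
      refine ⟨fun k => (κ m - 1) * c' k - (κ m' - 1) * c k, ?_⟩
      funext k
      simp only [Pi.sub_apply, Pi.smul_apply, smul_eq_mul, hc, hc']
      push_cast
      ring
    have := (Submodule.span ℝ W).smul_mem ((κ m' : ℝ) - 1)⁻¹ (Submodule.subset_span hmem)
    rw [smul_sub, smul_smul, smul_smul, inv_mul_cancel₀ hne, one_smul, mul_comm _⁻¹] at this
    exact this
  have hUW : U ≤ Submodule.span ℝ W := by
    refine (hmin {m | δ m ∈ Submodule.span ℝ W} hδW).trans (Submodule.span_le.2 ?_)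
    rintro _ ⟨m, hm, rfl⟩
    exact hm
  obtain ⟨B, hBW, hBspan, hBli⟩ := exists_linearIndependent ℝ W
  have hBfin : B.Finite := hBli.setFinite
  have hcoord : ∀ w : B, ∃ c : τ → ℤ, (w : τ → ℝ) = fun k => (c k : ℝ) := fun w => (hBW w.2).2
  choose b hb using hcoord
  have : Fintype B := hBfin.fintype
  let L := Fintype.linearCombination ℝ (fun w : B => (w : τ → ℝ))
  have hLinj : Function.Injective L := hBli.fintypeLinearCombination_injective
  obtain ⟨P, hP⟩ := LinearMap.exists_leftInverse_of_injective L (LinearMap.ker_eq_bot.2 hLinj)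
  have hrange : LinearMap.range L = U := by
    rw [Fintype.range_linearCombination, Subtype.range_coe, hBspan]
    exact le_antisymm hWU hUW
  have hPL : ∀ x, P (L x) = x := fun x => LinearMap.congr_fun hP x
  refine ⟨B, inferInstance, b, P, ?_, fun M hM => ?_⟩
  · filter_upwards [hM₀] with m hm
    have hmem : δ m ∈ LinearMap.range L := hrange ▸ Submodule.subset_span ⟨m, hm, rfl⟩
    obtain ⟨x, hx⟩ := hmem
    rw [← hx, hPL, Fintype.linearCombination_apply]
    exact Finset.sum_congr rfl fun w _ => by rw [← hb]
  · have himage : (fun m => P (δ m)) '' M = P '' (δ '' M) := by rw [Set.image_image]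
    rw [himage, Submodule.span_image, eq_top_iff]
    intro x _
    refine ⟨L x, hmin M hM ?_, hPL x⟩
    exact hrange ▸ LinearMap.mem_range_self L x

/-- Finite sums contain a multiple of `N` which is a return time of a rotation. -/
lemma exists_mem_FS_near_zero (a : ℕ → ℕ) {N : ℕ} (hN : 0 < N) {ι : Type*}
    (u : ι → ℝ) {V : Set (ι → ℝ)} (hV : V ∈ 𝓝 (0 : ι → ℝ)) :
    ∃ j : ℕ, N * j ∈ FS a ∧ ∃ c : ι → ℤ, (fun i => (j : ℝ) * u i - c i) ∈ V := by
  let s : ℕ → ℕ := fun i => ∑ l ∈ Finset.range i, a l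
  let h : ℕ → ι → ℝ := fun n i => Int.fract ((s n : ℝ) / N * u i)
  have hle : (hyperfilter ℕ : Filter ℕ) ≤ atTop := by
    rw [← Nat.cofinite_eq_atTop]
    exact hyperfilter_le_cofinite
  have hlim : ∀ i, ∃ y, Tendsto (fun n => h n i) (hyperfilter ℕ) (𝓝 y) := fun i =>
    (hyperfilter ℕ).exists_tendsto_of_eventually_abs_le (B := 1) (Eventually.of_forall fun n => by
      rw [Int.abs_fract]
      exact (Int.fract_lt_one _).le)
  choose y hy using hlim
  have hy' : Tendsto h (hyperfilter ℕ) (𝓝 y) := tendsto_pi_nhds.2 hy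
  have hdiff : Tendsto (fun n : ℕ × ℕ => h n.2 - h n.1)
      ((hyperfilter ℕ : Filter ℕ) ×ˢ (hyperfilter ℕ : Filter ℕ)) (𝓝 0) := by
    have := (hy'.comp tendsto_snd).sub (hy'.comp tendsto_fst)
    simpa [Function.comp_def] using this
  obtain ⟨r, -, hr⟩ := (Ultrafilter.eventually_exists_mem_iff (f := hyperfilter ℕ)
    (is := Set.Iio N) (P := fun r n => s n % N = r) (Set.finite_Iio N)).1
    (Eventually.of_forall fun n => ⟨_, Nat.mod_lt _ hN, rfl⟩)
  obtain ⟨n, hn, hnr⟩ := ((hdiff.eventually hV).curry.and hr).exists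
  obtain ⟨n', ⟨hn', hnr'⟩, hlt⟩ :=
    ((hn.and hr).and (hle (eventually_gt_atTop n))).exists
  have hsum : s n + ∑ l ∈ Finset.Ico n n', a l = s n' :=
    Finset.sum_range_add_sum_Ico _ hlt.le
  obtain ⟨j, hj⟩ : N ∣ ∑ l ∈ Finset.Ico n n', a l := by
    have h1 : s n ≡ s n' [MOD N] := hnr.trans hnr'.symm
    have h2 := (Nat.modEq_iff_dvd' (by omega)).1 h1
    rwa [← hsum, Nat.add_sub_cancel_left] at h2
  refine ⟨j, ⟨Finset.Ico n n', Finset.nonempty_Ico.2 hlt, hj.symm⟩,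
    fun i => ⌊(s n' : ℝ) / N * u i⌋ - ⌊(s n : ℝ) / N * u i⌋, ?_⟩
  have hn'' : h n' - h n ∈ V := hn'
  convert hn'' using 1
  funext i
  have hN' : (N : ℝ) ≠ 0 := by exact_mod_cast hN.ne'
  have hs : (s n' : ℝ) = s n + N * j := by
    rw [← hsum, hj]
    push_cast
    ring
  have hj' : (s n' : ℝ) / N * u i = (s n : ℝ) / N * u i + j * u i := by
    rw [hs]
    field_simp
  simp only [h, Pi.sub_apply, Int.fract]
  push_cast
  linarith

lemma exists_eventually_fract_natCast_mul_eq (q : Ultrafilter ℕ) {τ : Type*} [Finite τ]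
    (X : ℕ → τ → ℝ) (hX : ∀ n i, X n i ∈ Set.Ico (0 : ℝ) 1) (l : ℕ) :
    ∃ c : τ → ℤ, ∀ᶠ m in (q : Filter ℕ), ∀ i, Int.fract ((l : ℝ) * X m i) = l * X m i - c i := by
  have h : ∀ i, ∃ c : ℤ, ∀ᶠ m in (q : Filter ℕ), ⌊(l : ℝ) * X m i⌋ = c := by
    intro i
    obtain ⟨c, -, hc⟩ := (Ultrafilter.eventually_exists_mem_iff (f := q)
      (is := Set.Icc (0 : ℤ) l) (P := fun c m => ⌊(l : ℝ) * X m i⌋ = c) (Set.finite_Icc _ _)).1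
      (Eventually.of_forall fun m => ⟨_, ⟨by
        have := (hX m i).1
        positivity, by
        have h1 := (hX m i).2
        have h2 : (l : ℝ) * X m i ≤ (l : ℤ) := by
          push_cast
          exact mul_le_of_le_one_right (Nat.cast_nonneg _) h1.le
        exact_mod_cast (Int.floor_le _).trans h2⟩, rfl⟩)
    exact ⟨c, hc⟩
  choose c hc using h
  refine ⟨c, ?_⟩
  filter_upwards [eventually_all.2 hc] with m hm i
  rw [Int.fract, hm]

/-- Let `k ≥ 2`, `x⁰ ∈ [0,1)^d`, `xⁿ = {kⁿ x⁰}`, `T_l(x) = {l·x}`.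
Let `q` be a minimal idempotent ultrafilter, `p ∈ βℕ₀ + q`, and `S ⊆ [0,1)^d`
semialgebraic with `xⁿ ∈ S` for `p`-almost all `n`. Then
`{l : T_l(xⁿ) ∈ S for q-almost all n}` is IP*₊. -/
theorem torus_main_strong (d k : ℕ) (hk : 2 ≤ k) (x0 : Fin d → ℝ)
    (hx0 : ∀ i, x0 i ∈ Set.Ico (0 : ℝ) 1)
    (q : Ultrafilter ℕ) (hqidem : usum q q = q)
    (hqmin : ∀ r : Ultrafilter ℕ, ∃ s : Ultrafilter ℕ, usum s (usum r q) = q)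
    (p : Ultrafilter ℕ) (hp : ∃ r : Ultrafilter ℕ, p = usum r q)
    (S : Set (Fin d → ℝ)) (hS : IsSemialgebraic S)
    (hSsub : S ⊆ {y | ∀ i, y i ∈ Set.Ico (0 : ℝ) 1})
    (hmem : ∀ᶠ n in ↑p, (fun i => Int.fract ((k : ℝ) ^ n * x0 i)) ∈ S) :
    IsIPStarPlus {l : ℕ | ∀ᶠ n in ↑q,
      (fun i => Int.fract ((l : ℝ) * Int.fract ((k : ℝ) ^ n * x0 i))) ∈ S} := by
  classical
  have hq_atTop := le_atTop_of_minimal hqidem hqmin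
  set X : ℕ → Fin d → ℝ := fun n i => Int.fract ((k : ℝ) ^ n * x0 i) with hX
  have hXmem : ∀ n i, X n i ∈ Set.Ico (0 : ℝ) 1 := fun n i =>
    ⟨Int.fract_nonneg _, Int.fract_lt_one _⟩
  have hXadd : ∀ n m i, X (n + m) i = Int.fract (((k ^ n : ℕ) : ℝ) * X m i) := by
    intro n m i
    refine (Int.fract_eq_fract.2 ⟨-((k : ℤ) ^ n * ⌊(k : ℝ) ^ m * x0 i⌋), ?_⟩).symm
    simp only [hX, Int.fract]
    push_cast
    ring
  obtain ⟨r, rfl⟩ := hp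
  obtain ⟨a, ha⟩ := (eventually_usum.1 hmem).exists
  have hk0 : (0 : ℝ) < k := by exact_mod_cast (by omega : 0 < k)
  have hlimX : ∀ i, ∃ y, Tendsto (fun n => X n i) q (𝓝 y) := fun i =>
    q.exists_tendsto_of_eventually_abs_le (B := 1) (Eventually.of_forall fun n => by
      rw [abs_of_nonneg (hXmem n i).1]
      exact (hXmem n i).2.le)
  choose z hz using hlimX
  choose c hc using exists_eventually_fract_natCast_mul_eq q X hXmem
  set z' : Fin d → ℝ := fun i => (k : ℝ) ^ a * z i - c (k ^ a) i with hz'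
  set ε : ℕ → Fin d → ℝ := fun m i => X (a + m) i - z' i with hε
  set δ : ℕ → Fin d → ℝ := fun m i => (k : ℝ) ^ (a + m) * z i - c (k ^ (a + m)) i - z' i with hδ
  have hεX : ∀ᶠ m in (q : Filter ℕ), ∀ i, ε m i = (k : ℝ) ^ a * (X m i - z i) := by
    filter_upwards [hc (k ^ a)] with m hm i
    simp only [hε, hz']
    rw [hXadd, hm]
    push_cast
    ring
  have hε0 : Tendsto ε q (𝓝 0) := by
    refine tendsto_pi_nhds.2 fun i => ?_
    have h1 : Tendsto (fun m => (k : ℝ) ^ a * (X m i - z i)) q (𝓝 0) := by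
      have := ((hz i).sub_const (z i)).const_mul ((k : ℝ) ^ a)
      simpa using this
    refine h1.congr' ?_
    filter_upwards [hεX] with m hm
    rw [hm]
  have hεadd : ∀ m, ∀ᶠ m' in (q : Filter ℕ), ε (m + m') = δ m + (k : ℝ) ^ m • ε m' := by
    intro m
    filter_upwards [hc (k ^ (a + m)), hεX] with m' h1 h2
    funext i
    have h3 : ε (m + m') i = X (a + m + m') i - z' i := by rw [add_assoc]
    rw [h3, hXadd, h1, Pi.add_apply, Pi.smul_apply, smul_eq_mul, h2]
    simp only [hδ]
    push_cast
    ring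
  have hκ : Tendsto (fun m : ℕ => (k : ℝ) ^ m) q atTop :=
    (tendsto_pow_atTop_atTop_of_one_lt (by exact_mod_cast hk)).mono_left hq_atTop
  have hδ0 : Tendsto δ q (𝓝 0) := by
    refine hε0.usum_self hqidem (Eventually.of_forall fun m => ?_)
    have h1 : Tendsto (fun m' => δ m + (k : ℝ) ^ m • ε m') q (𝓝 (δ m)) := by
      have := (hε0.const_smul ((k : ℝ) ^ m)).const_add (δ m)
      simpa using this
    exact h1.congr' ((hεadd m).mono fun m' hm' => hm'.symm)
  have hδadd : ∀ m, ∀ᶠ m' in (q : Filter ℕ), δ (m + m') = δ m + (k : ℝ) ^ m • δ m' := by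
    intro m
    filter_upwards [(hεadd m).usum_self hqidem] with m' hm'
    obtain ⟨n, h1, h2, h3⟩ := (hm'.and ((hεadd m').and (hεadd (m + m')))).exists
    rw [← add_assoc, h3, h2, smul_add, smul_smul, ← pow_add, ← add_assoc] at h1
    exact add_right_cancel h1
  obtain ⟨ι, _, b, P, hPδ, hspan⟩ := exists_integer_coordinates q
    (κ := fun m => (k : ℤ) ^ m) (by simpa using hκ) hδ0 (fun i => (k : ℝ) ^ a * z i) (fun m =>
      ⟨fun i => c (k ^ (a + m)) i - c (k ^ a) i, fun i => by
        simp only [hδ, hz']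
        push_cast
        ring⟩)
  have hη0 : Tendsto (fun m => P (δ m)) q (𝓝 0) := by
    have := (P.continuous_of_finiteDimensional.tendsto 0).comp hδ0
    simpa [Function.comp_def] using this
  have hηadd : ∀ᶠ m in (q : Filter ℕ), ∀ᶠ m' in (q : Filter ℕ),
      P (δ (m + m')) = P (δ m) + (k : ℝ) ^ m • P (δ m') :=
    Eventually.of_forall fun m => (hδadd m).mono fun m' hm' => by rw [hm', map_add, map_smul]
  have hεη : ∀ᶠ m in (q : Filter ℕ), ∀ᶠ m' in (q : Filter ℕ),
      ε (m + m') = ∑ i, P (δ m) i • (fun j => (b i j : ℝ)) + (k : ℝ) ^ m • ε m' := by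
    filter_upwards [hPδ] with m hm
    rw [← hm]
    exact hεadd m
  obtain ⟨R, F, G, hSeq⟩ := hS
  obtain ⟨i₀, hi₀⟩ : ∃ i₀, ∀ᶠ m in (q : Filter ℕ), z' + ε m ∈ basicSemialg (F i₀) (G i₀) := by
    refine Ultrafilter.eventually_exists_iff.1 (ha.mono fun m hm => ?_)
    have hm' : X (a + m) ∈ S := hm
    have : z' + ε m = X (a + m) := by
      funext i
      simp [hε]
    rw [this]
    rw [hSeq] at hm'
    exact Set.mem_iUnion.1 hm'
  have hsign := fun (f : MvPolynomial (Fin d) ℝ) (s : SignType) =>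
    eventually_sign_eval_perturbed hqidem hκ z' (fun i j => (b i j : ℝ)) hη0 hηadd hspan hεη f
      (s := s)
  have hF : ∀ᶠ m in (q : Filter ℕ), ∀ f ∈ F i₀, _ :=
    (eventually_all_finset _).2 fun f hf => hsign f 0 (hi₀.mono fun m hm => by
      rw [hm.1 f hf, sign_zero])
  have hG : ∀ᶠ m in (q : Filter ℕ), ∀ g ∈ G i₀, _ :=
    (eventually_all_finset _).2 fun g hg => hsign g 1 (hi₀.mono fun m hm =>
      sign_pos (hm.2 g hg))
  obtain ⟨m, hmF, hmG, hmδ, hm1⟩ :=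
    (hF.and (hG.and (hPδ.and (hκ.eventually_gt_atTop 1)))).exists
  have hkm : 1 < k ^ m := by exact_mod_cast hm1
  refine ⟨(k : ℤ) ^ (a + m), ?_⟩
  rintro A ⟨α, -, hαA⟩
  have hV : ∀ᶠ θ in 𝓝 (0 : ι → ℝ), _ :=
    ((eventually_all_finset _).2 hmF).and ((eventually_all_finset _).2 hmG)
  obtain ⟨j, hj, e, hjV⟩ := exists_mem_FS_near_zero α (N := k ^ a * (k ^ m - 1))
    (Nat.mul_pos (by positivity) (by omega)) (P (δ m)) hV
  set n := k ^ a * (k ^ m - 1) * j with hn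
  refine ⟨n, ⟨n + k ^ (a + m), ?_, by push_cast; ring⟩, hαA hj⟩
  set θ : ι → ℝ := fun i => (j : ℝ) * P (δ m) i - e i with hθ
  set t : ℝ := (k : ℝ) ^ m + n / (k : ℝ) ^ a with ht
  have ht0 : 0 < t := by positivity
  have hncast : (n : ℝ) = (k : ℝ) ^ a * ((k : ℝ) ^ m - 1) * j := by
    rw [hn]
    push_cast [Nat.cast_sub hkm.le]
    ring
  have hevF := (eventually_all_finset (F i₀)).2 fun f hf => hjV.1 f hf t ht0
  have hevG := (eventually_all_finset (G i₀)).2 fun g hg => hjV.2 g hg t ht0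
  filter_upwards [hevF, hevG, hεX] with m' h1 h2 h3
  set y : Fin d → ℝ :=
    z' + ∑ i, (P (δ m) i + θ i) • (fun l => (b i l : ℝ)) + t • ε m' with hy
  have hyS : y ∈ S := by
    rw [hSeq]
    exact Set.mem_iUnion.2 ⟨i₀, fun f hf => sign_eq_zero_iff.1 (h1 f hf),
      fun g hg => sign_eq_one_iff.1 (h2 g hg)⟩
  convert hyS using 1
  funext l
  refine Int.fract_eq_iff.2 ⟨(hSsub hyS l).1, (hSsub hyS l).2,
    c (k ^ (a + m)) l + ∑ i, e i * b i l + j * (c (k ^ (a + m)) l - c (k ^ a) l), ?_⟩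
  have hδl : δ m l = ∑ i, P (δ m) i * (b i l : ℝ) := by
    have := congrFun hmδ l
    simpa [Finset.sum_apply] using this
  have hyl : y l = z' l + (δ m l + (j * δ m l - ∑ i, (e i : ℝ) * b i l)) + t * ε m' l := by
    rw [hδl, Finset.mul_sum, ← Finset.sum_sub_distrib, ← Finset.sum_add_distrib]
    simp only [hy, hθ, Pi.add_apply, Finset.sum_apply, Pi.smul_apply, smul_eq_mul]
    congr 2
    exact Finset.sum_congr rfl fun i _ => by ring
  have htε : t * ε m' l = ((k : ℝ) ^ (a + m) + n) * (X m' l - z l) := by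
    rw [h3, ht]
    field_simp
    ring
  have hX' : Int.fract ((k : ℝ) ^ m' * x0 l) = X m' l := rfl
  rw [hyl, htε, hX']
  simp only [hδ, hz']
  push_cast
  rw [hncast]
  ring
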